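/- arXiv:2110.00227 — 6 statements merged into one kernel-verified Lean document; each statement's English description precedes it below -/
import Mathlib

section
/- Let n and s be positive integers and let F be a finite set of unit vectors in ℝ^n (i.e., F is contained in the unit sphere S^{n-1}). Suppose the set P(F) = { ⟨x,y⟩ : x, y ∈ F, x ≠ y } of inner products of distinct elements of F consists of exactly s distinct real numbers t_1, …, t_s, and suppose t_1 + ⋯ + t_s = 0. Then |F| ≤ C(n+s-1, s) + C(n+s-4, s-3), where C(a,b) denotes the binomial coefficient with the convention C(a,b) = 0 when b < 0. -/
open scoped RealInnerProductSpace

/-- The functions on `ι` spanned by the degree `d` monomials in the coordinates of `u : ι → κ → ℝ`. -/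
def monomialSpan {ι κ : Type*} (u : ι → κ → ℝ) (d : ℕ) : Submodule ℝ (ι → ℝ) :=
  Submodule.span ℝ (Set.range fun (m : Sym κ d) (a : ι) => ((m : Multiset κ).map (u a)).prod)

theorem finrank_monomialSpan_le {ι κ : Type*} [Fintype ι] [Fintype κ] (u : ι → κ → ℝ) (d : ℕ) :
    Module.finrank ℝ (monomialSpan u d) ≤ (Fintype.card κ + d - 1).choose d := by
  classical
  rw [← Sym.card_sym_eq_choose (α := κ) d]
  exact finrank_range_le_card _

theorem coord_mul_mem_monomialSpan {ι κ : Type*} (u : ι → κ → ℝ) (d : ℕ) (i : κ)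
    {f : ι → ℝ} (hf : f ∈ monomialSpan u d) :
    (fun a => u a i * f a) ∈ monomialSpan u (d + 1) := by
  induction hf using Submodule.span_induction with
  | mem f hf =>
    obtain ⟨m, rfl⟩ := hf
    refine Submodule.subset_span ⟨Sym.cons i m, ?_⟩
    ext a
    simp [Sym.coe_cons]
  | zero =>
    convert (monomialSpan u (d + 1)).zero_mem using 1
    ext a
    simp
  | add f g _ _ hf hg => simpa [mul_add] using! (monomialSpan u (d + 1)).add_mem hf hg
  | smul c f _ hf => simpa [mul_left_comm] using! (monomialSpan u (d + 1)).smul_mem c hf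

theorem sum_mul_mem_monomialSpan {ι κ : Type*} [Fintype κ] (u : ι → κ → ℝ) (d : ℕ) (v : κ → ℝ)
    {f : ι → ℝ} (hf : f ∈ monomialSpan u d) :
    (fun a => (∑ i, u a i * v i) * f a) ∈ monomialSpan u (d + 1) := by
  have h := Submodule.sum_mem (monomialSpan u (d + 1)) (t := Finset.univ) fun i _ =>
    Submodule.smul_mem _ (v i) (coord_mul_mem_monomialSpan u d i hf)
  convert h using 1
  ext a
  simp only [Finset.sum_apply, Pi.smul_apply, smul_eq_mul, Finset.sum_mul]
  exact Finset.sum_congr rfl fun i _ => by ring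

theorem sum_mul_pow_mem_monomialSpan {ι κ : Type*} [Fintype κ] (u : ι → κ → ℝ) (d : ℕ)
    (v : κ → ℝ) : (fun a => (∑ i, u a i * v i) ^ d) ∈ monomialSpan u d := by
  induction d with
  | zero => exact Submodule.subset_span ⟨Sym.nil, by ext a; simp⟩
  | succ d ih => simpa only [pow_succ'] using sum_mul_mem_monomialSpan u d v ih

theorem monomialSpan_le_add_two_mul {ι κ : Type*} [Fintype κ] (u : ι → κ → ℝ)
    (hu : ∀ a, ∑ i, u a i ^ 2 = 1) (d k : ℕ) :
    monomialSpan u d ≤ monomialSpan u (d + 2 * k) := by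
  induction k with
  | zero => exact le_rfl
  | succ k ih =>
    refine ih.trans fun f hf => ?_
    have h := Submodule.sum_mem (monomialSpan u (d + 2 * k + 1 + 1)) (t := Finset.univ) fun i _ =>
      coord_mul_mem_monomialSpan u _ i (coord_mul_mem_monomialSpan u _ i hf)
    rw [show d + 2 * (k + 1) = d + 2 * k + 1 + 1 by ring]
    convert h using 1
    ext a
    simp_rw [Finset.sum_apply, ← mul_assoc, ← Finset.sum_mul, ← pow_two, hu, one_mul]

/-- A spherical `s`-distance set `F` in `ℝⁿ` whose `s` distinct inner products
`t 1, …, t s` sum to zero satisfies `|F| ≤ C(n+s-1, s) + C(n+s-4, s-3)`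
(with the convention that the second binomial coefficient is `0` when `s < 3`). -/
theorem spherical_s_distance_bound (n s : ℕ) (hn : 0 < n) (hs : 0 < s)
    (F : Finset (EuclideanSpace ℝ (Fin n)))
    (hF : ∀ x ∈ F, ‖x‖ = 1)
    (t : Fin s → ℝ) (ht : Function.Injective t)
    (hP : {p : ℝ | ∃ x ∈ F, ∃ y ∈ F, x ≠ y ∧ ⟪x, y⟫ = p} = Set.range t)
    (hsum : ∑ k, t k = 0) :
    F.card ≤ (n + s - 1).choose s + (if 3 ≤ s then (n + s - 4).choose (s - 3) else 0) := by
  classical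
  let u : F → Fin n → ℝ := fun a i => a.1 i
  have hu : ∀ a, ∑ i, u a i ^ 2 = 1 := fun a => by
    rw [← EuclideanSpace.real_norm_sq_eq, hF a a.2, one_pow]
  have hinner (a b : F) : ⟪a.1, b.1⟫ = ∑ i, u a i * u b i := by
    simp [PiLp.inner_apply, u, mul_comm]
  let W : Submodule ℝ (F → ℝ) := if 3 ≤ s then monomialSpan u (s - 3) else ⊥
  have hW : Module.finrank ℝ W ≤ if 3 ≤ s then (n + s - 4).choose (s - 3) else 0 := by
    by_cases h : 3 ≤ s
    · have h' := finrank_monomialSpan_le u (s - 3)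
      rw [Fintype.card_fin, show n + (s - 3) - 1 = n + s - 4 by omega] at h'
      have hWh : W = monomialSpan u (s - 3) := if_pos h
      rwa [if_pos h, hWh]
    · simp [W, h]
  let p : Polynomial ℝ := ∏ k, (Polynomial.X - Polynomial.C (t k))
  have hdeg : p.natDegree = s := by simp [p]
  have hcoeff : p.coeff (s - 1) = 0 := by
    have h := Polynomial.prod_X_sub_C_coeff_card_pred Finset.univ t (by simpa using hs)
    simpa [hsum] using h
  have hmem (b : F) : (fun a : F => p.eval ⟪a.1, b.1⟫) ∈ monomialSpan u s ⊔ W := by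
    have h : (fun a : F => p.eval ⟪a.1, b.1⟫) =
        ∑ j ∈ Finset.range (s + 1), p.coeff j • fun a : F => (∑ i, u a i * u b i) ^ j := by
      ext a
      simp [Polynomial.eval_eq_sum_range, hdeg, hinner]
    rw [h]
    refine Submodule.sum_mem _ fun j hj => ?_
    rw [Finset.mem_range] at hj
    have hpow := sum_mul_pow_mem_monomialSpan u j (u b)
    by_cases hj1 : j = s - 1
    · simp [hj1, hcoeff]
    refine Submodule.smul_mem _ _ ?_
    by_cases hpar : (s - j) % 2 = 0
    · refine Submodule.mem_sup_left ?_
      have h2 := monomialSpan_le_add_two_mul u hu j ((s - j) / 2) hpow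
      rwa [show j + 2 * ((s - j) / 2) = s by omega] at h2
    · refine Submodule.mem_sup_right ?_
      have h2 := monomialSpan_le_add_two_mul u hu j ((s - 3 - j) / 2) hpow
      rw [show j + 2 * ((s - 3 - j) / 2) = s - 3 by omega] at h2
      simpa only [W, if_pos (show 3 ≤ s by omega)] using h2
  have hroot {a b : F} (hab : a ≠ b) : p.eval ⟪a.1, b.1⟫ = 0 := by
    have h : ⟪a.1, b.1⟫ ∈ Set.range t := by
      rw [← hP]
      exact ⟨a, a.2, b, b.2, fun h => hab (Subtype.ext h), rfl⟩
    obtain ⟨k, hk⟩ := h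
    rw [Polynomial.eval_prod]
    exact Finset.prod_eq_zero (Finset.mem_univ k) (by simp [hk])
  have hone : p.eval 1 ≠ 0 := by
    rw [Polynomial.eval_prod, Finset.prod_ne_zero_iff]
    intro k _ hk
    have h : t k ∈ Set.range t := ⟨k, rfl⟩
    rw [← hP] at h
    obtain ⟨x, hx, y, hy, hxy, hxyk⟩ := h
    refine hxy ((inner_eq_one_iff_of_norm_eq_one (𝕜 := ℝ) (hF x hx) (hF y hy)).1 ?_)
    rw [hxyk]
    simp only [Polynomial.eval_sub, Polynomial.eval_X, Polynomial.eval_C] at hk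
    linarith
  have htop : monomialSpan u s ⊔ W = ⊤ := by
    rw [eq_top_iff, ← (Pi.basisFun ℝ F).span_eq, Submodule.span_le]
    rintro _ ⟨b, rfl⟩
    have h := Submodule.smul_mem _ (p.eval 1)⁻¹ (hmem b)
    convert! h using 1
    ext a
    by_cases hab : a = b
    · subst hab
      simp [hF a a.2, hone]
    · simp [hroot hab, hab]
  calc F.card = Module.finrank ℝ (monomialSpan u s ⊔ W : Submodule ℝ (F → ℝ)) := by
        rw [htop, finrank_top]; simp
    _ ≤ Module.finrank ℝ (monomialSpan u s) + Module.finrank ℝ W :=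
        Submodule.finrank_add_le_finrank_add_finrank _ _
    _ ≤ _ := add_le_add (by simpa using finrank_monomialSpan_le u s) hW
end

section
/- Let n ≥ 1 and d ≥ 0 be integers. The real vector space Γ_{≤d}(S^{n-1}) of functions from the unit sphere S^{n-1} ⊂ ℝ^n to ℝ that arise as restrictions to S^{n-1} of real polynomials in n variables of total degree at most d has dimension C(n+d−1, d) + C(n+d−2, d−1), with the convention C(a,b) = 0 when b < 0. -/
namespace MvPolynomial

/-- Homogeneous polynomials of degree `k` in `n` variables form a space of dimension
`C(n+k-1, k)`. -/
lemma finrank_homogeneousSubmodule (R σ : Type*) [CommRing R] [Nontrivial R] [Fintype σ] (k : ℕ) :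
    Module.finrank R (homogeneousSubmodule σ R k) = (Fintype.card σ + k - 1).choose k := by
  classical
  have hset : {d : σ →₀ ℕ | d.degree = k} = ↑(Finset.univ.finsuppAntidiag k : Finset (σ →₀ ℕ)) := by
    ext d
    simp [Finsupp.degree_eq_sum]
  rw [homogeneousSubmodule_eq_finsupp_supported, hset,
    (AddMonoidAlgebra.supportedEquivFinsupp _).finrank_eq, Module.finrank_finsupp_self]
  simp [Finset.card_finsuppAntidiag_nat_eq_choose]

lemma IsHomogeneous.eval_smul {R σ : Type*} [CommSemiring R] {F : MvPolynomial σ R} {k : ℕ}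
    (hF : F.IsHomogeneous k) (r : R) (x : σ → R) : eval (r • x) F = r ^ k * eval x F := by
  rw [eval_eq, eval_eq, Finset.mul_sum]
  refine Finset.sum_congr rfl fun d hd => ?_
  have hdeg : d.degree = k := by
    rw [Finsupp.degree_eq_weight_one]
    exact hF (mem_support_iff.mp hd)
  simp only [Pi.smul_apply, smul_eq_mul, mul_pow, Finset.prod_mul_distrib,
    Finset.prod_pow_eq_pow_sum]
  rw [← hdeg, Finsupp.degree_apply]
  ring

variable {ι : Type*} [Fintype ι]

variable (ι) in
/-- Restriction of polynomials to functions on the Euclidean unit sphere. -/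
noncomputable def restrictSphere :
    MvPolynomial ι ℝ →ₗ[ℝ] (Metric.sphere (0 : EuclideanSpace ℝ ι) 1 → ℝ) :=
  LinearMap.pi fun p => (aeval fun j => (p : EuclideanSpace ℝ ι) j).toLinearMap

lemma restrictSphere_apply (F : MvPolynomial ι ℝ) (p : Metric.sphere (0 : EuclideanSpace ℝ ι) 1) :
    restrictSphere ι F p = eval (fun j => (p : EuclideanSpace ℝ ι) j) F := by
  simp [restrictSphere]

lemma IsHomogeneous.eq_zero_of_restrictSphere_eq_zero [Nonempty ι] {F : MvPolynomial ι ℝ} {k : ℕ}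
    (hF : F.IsHomogeneous k) (h : restrictSphere ι F = 0) : F = 0 := by
  refine hF.eq_zero_of_forall_eval_eq_zero fun x => ?_
  obtain ⟨r, p, hp, hx⟩ : ∃ (r : ℝ) (p : EuclideanSpace ℝ ι), p ∈ Metric.sphere 0 1 ∧
      x = r • fun j => p j := by
    by_cases hx : WithLp.toLp 2 x = (0 : EuclideanSpace ℝ ι)
    · obtain ⟨p, hp⟩ := (NormedSpace.sphere_nonempty (E := EuclideanSpace ℝ ι) (x := 0)).mpr
        zero_le_one
      refine ⟨0, p, hp, ?_⟩
      ext j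
      simpa using congrArg (fun v : EuclideanSpace ℝ ι => v j) hx
    · refine ⟨‖WithLp.toLp 2 x‖, ‖WithLp.toLp 2 x‖⁻¹ • WithLp.toLp 2 x, ?_, ?_⟩
      · simp [norm_smul, norm_ne_zero_iff.mpr hx]
      · ext j
        simp [norm_ne_zero_iff.mpr hx]
  have hFp := restrictSphere_apply F ⟨p, hp⟩
  rw [h] at hFp
  rw [hx, hF.eval_smul, ← hFp]
  simp

variable (ι) in
/-- The functions on the unit sphere that are restrictions of homogeneous polynomials of
degree `k`. -/
noncomputable def sphereForms (k : ℕ) :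
    Submodule ℝ (Metric.sphere (0 : EuclideanSpace ℝ ι) 1 → ℝ) :=
  (homogeneousSubmodule ι ℝ k).map (restrictSphere ι)

instance finiteDimensional_sphereForms (k : ℕ) : FiniteDimensional ℝ (sphereForms ι k) :=
  Module.Finite.of_fg ((homogeneousSubmodule_fg ι ℝ k).map _)

lemma finrank_sphereForms [Nonempty ι] (k : ℕ) :
    Module.finrank ℝ (sphereForms ι k) = (Fintype.card ι + k - 1).choose k := by
  have hinj : Function.Injective ((restrictSphere ι).domRestrict (homogeneousSubmodule ι ℝ k)) := by
    rw [injective_iff_map_eq_zero]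
    rintro ⟨F, hF⟩ h
    exact Subtype.ext (IsHomogeneous.eq_zero_of_restrictSphere_eq_zero hF h)
  rw [← finrank_homogeneousSubmodule ℝ ι k, ← LinearMap.finrank_range_of_inj hinj,
    LinearMap.range_domRestrict, sphereForms]

lemma apply_neg_of_mem_sphereForms {k : ℕ} {φ : Metric.sphere (0 : EuclideanSpace ℝ ι) 1 → ℝ}
    (hφ : φ ∈ sphereForms ι k) (p : Metric.sphere (0 : EuclideanSpace ℝ ι) 1) :
    φ (-p) = (-1) ^ k * φ p := by
  obtain ⟨F, hF, rfl⟩ := hφ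
  rw [restrictSphere_apply, restrictSphere_apply, ← IsHomogeneous.eval_smul hF]
  congr 2
  ext j
  simp

lemma disjoint_sphereForms_succ (k : ℕ) : Disjoint (sphereForms ι (k + 1)) (sphereForms ι k) := by
  rw [Submodule.disjoint_def]
  intro φ h₁ h₀
  ext p
  have h := (apply_neg_of_mem_sphereForms h₁ p).symm.trans (apply_neg_of_mem_sphereForms h₀ p)
  rw [pow_succ] at h
  have hk : (-1 : ℝ) ^ k ≠ 0 := by simp
  have h2 : (-1 : ℝ) ^ k * φ p = 0 := by linarith
  simpa [hk] using h2

lemma sphereForms_le_add_two (k : ℕ) : sphereForms ι k ≤ sphereForms ι (k + 2) := by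
  rintro _ ⟨F, hF, rfl⟩
  refine ⟨F * ∑ j, X j ^ 2, ?_, ?_⟩
  · exact IsHomogeneous.mul hF
      (IsHomogeneous.sum _ _ _ fun j _ => by simpa using (isHomogeneous_X ℝ j).pow 2)
  · ext p
    have hp : ∑ j, (p : EuclideanSpace ℝ ι) j ^ 2 = 1 := by
      rw [← EuclideanSpace.real_norm_sq_eq, norm_eq_of_mem_sphere p, one_pow]
    simp [restrictSphere_apply, hp]

lemma sphereForms_le_add_two_mul (k m : ℕ) : sphereForms ι k ≤ sphereForms ι (k + 2 * m) := by
  induction m with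
  | zero => simp
  | succ m ih => exact ih.trans (sphereForms_le_add_two _)

lemma sphereForms_le_sup {k d : ℕ} (hk : k ≤ d + 1) :
    sphereForms ι k ≤ sphereForms ι (d + 1) ⊔ sphereForms ι d := by
  rcases Nat.even_or_odd' (d + 1 - k) with ⟨m, hm | hm⟩
  · rw [show d + 1 = k + 2 * m by lia]
    exact (sphereForms_le_add_two_mul k m).trans le_sup_left
  · rw [show d = k + 2 * m by lia]
    exact (sphereForms_le_add_two_mul k m).trans le_sup_right

lemma map_restrictSphere_restrictTotalDegree (d : ℕ) :
    (restrictTotalDegree ι ℝ d).map (restrictSphere ι) = ⨆ k ≤ d, sphereForms ι k := by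
  apply le_antisymm
  · rintro _ ⟨F, hF, rfl⟩
    have hF' : F.totalDegree ≤ d := (mem_restrictTotalDegree ι d F).mp hF
    rw [← sum_homogeneousComponent F, map_sum]
    refine Submodule.sum_mem _ fun k hk => ?_
    have hkd : k ≤ d := by
      rw [Finset.mem_range] at hk
      lia
    exact le_iSup₂ (f := fun k (_ : k ≤ d) => sphereForms ι k) k hkd
      ⟨_, homogeneousComponent_isHomogeneous k F, rfl⟩
  · refine iSup₂_le fun k hk => Submodule.map_mono fun F hF => ?_
    exact (mem_restrictTotalDegree ι d F).mpr ((IsHomogeneous.totalDegree_le hF).trans hk)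

lemma iSup_sphereForms_succ (d : ℕ) :
    ⨆ k ≤ d + 1, sphereForms ι k = sphereForms ι (d + 1) ⊔ sphereForms ι d := by
  refine le_antisymm (iSup₂_le fun k hk => sphereForms_le_sup hk) (sup_le ?_ ?_)
  · exact le_iSup₂ (f := fun k (_ : k ≤ d + 1) => sphereForms ι k) (d + 1) le_rfl
  · exact le_iSup₂ (f := fun k (_ : k ≤ d + 1) => sphereForms ι k) d d.le_succ

end MvPolynomial

open MvPolynomial in

/-- The space `Γ_{≤d}(S^{n-1})` of real-valued functions on the unit sphere in `ℝⁿ`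
that are restrictions of polynomials of total degree at most `d` has dimension
`C(n+d−1, d) + C(n+d−2, d−1)` (the second term being `0` when `d = 0`). -/
theorem finrank_polynomial_functions_sphere (n d : ℕ) (hn : 1 ≤ n) :
    Module.finrank ℝ
      (Submodule.span ℝ
        {φ : Metric.sphere (0 : EuclideanSpace ℝ (Fin n)) 1 → ℝ |
          ∃ F : MvPolynomial (Fin n) ℝ, F.totalDegree ≤ d ∧
            ∀ p : Metric.sphere (0 : EuclideanSpace ℝ (Fin n)) 1,
              φ p = MvPolynomial.eval (fun j => (p : EuclideanSpace ℝ (Fin n)) j) F})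
      = (n + d - 1).choose d + (if 1 ≤ d then (n + d - 2).choose (d - 1) else 0) := by
  have : Nonempty (Fin n) := ⟨⟨0, hn⟩⟩
  have hset : {φ : Metric.sphere (0 : EuclideanSpace ℝ (Fin n)) 1 → ℝ |
      ∃ F : MvPolynomial (Fin n) ℝ, F.totalDegree ≤ d ∧
        ∀ p : Metric.sphere (0 : EuclideanSpace ℝ (Fin n)) 1,
          φ p = MvPolynomial.eval (fun j => (p : EuclideanSpace ℝ (Fin n)) j) F} =
      ((restrictTotalDegree (Fin n) ℝ d).map (restrictSphere (Fin n)) : Set _) := by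
    ext φ
    simp only [Set.mem_ofPred_eq, Submodule.map_coe, Set.mem_image, SetLike.mem_coe,
      mem_restrictTotalDegree, funext_iff, restrictSphere_apply, eq_comm]
  rw [hset, Submodule.span_eq, map_restrictSphere_restrictTotalDegree]
  cases d with
  | zero =>
    have h : ⨆ k ≤ 0, sphereForms (Fin n) k = sphereForms (Fin n) 0 := by
      simp only [Nat.le_zero, iSup_iSup_eq_left]
    rw [h, finrank_sphereForms]
    simp
  | succ d =>
    have h := Submodule.finrank_sup_add_finrank_inf_eq (sphereForms (Fin n) (d + 1))
      (sphereForms (Fin n) d)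
    rw [(disjoint_sphereForms_succ d).eq_bot, finrank_bot, add_zero] at h
    rw [iSup_sphereForms_succ, h, finrank_sphereForms, finrank_sphereForms, Fintype.card_fin,
      if_pos (Nat.le_add_left 1 d), Nat.add_sub_cancel, show n + (d + 1) - 2 = n + d - 1 by lia]
end

section
/- Let n ≥ 1 and d ≥ 0 be integers. The real vector space of functions from the unit sphere S^{n-1} ⊂ ℝ^n to ℝ spanned by the restrictions to S^{n-1} of the monomials x_1^{i_1} ⋯ x_n^{i_n} with i_1 ≤ 1 and i_1 + ⋯ + i_n = d has dimension C(n+d−2, d) + C(n+d−3, d−1), with the convention C(a,b) = 0 when b < 0. -/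
open MvPolynomial in
/-- Distinct monomials of the same total degree are linearly independent as functions on the
unit sphere. -/
theorem linearIndependent_monomials_sphere {n : ℕ} (hn : 1 ≤ n) (d : ℕ) :
    LinearIndependent ℝ (fun (i : {i : Fin n → ℕ // ∑ j, i j = d})
      (p : Metric.sphere (0 : EuclideanSpace ℝ (Fin n)) 1) =>
        ∏ j, ((p : EuclideanSpace ℝ (Fin n)) j) ^ (i.1 j)) := by
  rw [linearIndependent_iff']
  intro s g hg i hi
  let e : {i : Fin n → ℕ // ∑ j, i j = d} → (Fin n →₀ ℕ) :=
    fun i => Finsupp.equivFunOnFinite.symm i.1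
  have he : Function.Injective e := Finsupp.equivFunOnFinite.symm.injective.comp
    Subtype.val_injective
  have eval_sum (x : Fin n → ℝ) :
      eval x (∑ k ∈ s, monomial (e k) (g k)) = ∑ k ∈ s, g k * ∏ j, x j ^ k.1 j := by
    simp [map_sum, eval_monomial, Finsupp.prod_fintype, e]
  have hP : ∑ k ∈ s, monomial (e k) (g k) = 0 := by
    refine funext_set (fun _ => Set.Ioi (0 : ℝ)) (fun _ => Set.Ioi_infinite 0) fun x hx => ?_
    rw [eval_sum, map_zero]
    let y : EuclideanSpace ℝ (Fin n) := WithLp.toLp 2 x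
    have hy : y ≠ 0 := fun h => by
      have hpos : 0 < x ⟨0, hn⟩ := hx ⟨0, hn⟩ trivial
      exact hpos.ne' (congrArg (fun z : EuclideanSpace ℝ (Fin n) => z ⟨0, hn⟩) h)
    have hp : ‖y‖⁻¹ • y ∈ Metric.sphere (0 : EuclideanSpace ℝ (Fin n)) 1 := by
      simp [norm_smul, hy]
    have h := congrFun hg ⟨_, hp⟩
    have hscale : ∑ k ∈ s, g k * ∏ j, (‖y‖⁻¹ * x j) ^ k.1 j =
        ‖y‖⁻¹ ^ d * ∑ k ∈ s, g k * ∏ j, x j ^ k.1 j := by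
      rw [Finset.mul_sum]
      refine Finset.sum_congr rfl fun k _ => ?_
      simp only [mul_pow, Finset.prod_mul_distrib, Finset.prod_pow_eq_pow_sum, k.2]
      ring
    simp only [Finset.sum_apply, Pi.smul_apply, smul_eq_mul, PiLp.smul_apply, Pi.zero_apply] at h
    exact (mul_eq_zero.mp (hscale.symm.trans h)).resolve_left
      (pow_ne_zero _ (inv_ne_zero (norm_ne_zero_iff.mpr hy)))
  have hc := congrArg (coeff (e i)) hP
  simpa [coeff_sum, coeff_monomial, he.eq_iff, hi] using hc

theorem card_fun_sum_eq (m d : ℕ) :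
    Nat.card {i : Fin m → ℕ // ∑ j, i j = d} = m.multichoose d := by
  rw [← Nat.card_congr (Sym.equivNatSumOfFintype (Fin m) d), Nat.card_eq_fintype_card,
    Sym.card_sym_fin_eq_multichoose]

/-- Exponent vectors whose first entry is at most `1`, split by that entry. -/
def exponentsEquivSum (m d : ℕ) :
    {i : Fin (m + 1) → ℕ // i 0 ≤ 1 ∧ ∑ j, i j = d} ≃
      {i : Fin m → ℕ // ∑ j, i j = d} ⊕ {i : Fin m → ℕ // ∑ j, i j + 1 = d} where
  toFun i :=
    if h : i.1 0 = 0 then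
      .inl ⟨Fin.tail i.1, by simpa [Fin.sum_univ_succ, Fin.tail, h] using i.2.2⟩
    else
      .inr ⟨Fin.tail i.1, by
        have h0 := i.2.1
        have hs := i.2.2
        rw [Fin.sum_univ_succ] at hs
        simp only [Fin.tail]
        omega⟩
  invFun := Sum.elim
    (fun i => ⟨Fin.cons 0 i.1, by simp [Fin.sum_univ_succ, i.2]⟩)
    (fun i => ⟨Fin.cons 1 i.1, by simp [Fin.sum_univ_succ, ← i.2, add_comm]⟩)
  left_inv i := by
    by_cases h : i.1 0 = 0
    · simp only [h, dite_true, Sum.elim_inl]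
      exact Subtype.ext ((congrArg (Fin.cons · (Fin.tail i.1)) h.symm).trans
        (Fin.cons_self_tail i.1))
    · have h1 : i.1 0 = 1 := by have := i.2.1; omega
      simp only [h, dite_false, Sum.elim_inr]
      exact Subtype.ext ((congrArg (Fin.cons · (Fin.tail i.1)) h1.symm).trans
        (Fin.cons_self_tail i.1))
  right_inv i := by
    rcases i with i | i <;> simp

instance finite_fun_sum_eq (m d : ℕ) : Finite {i : Fin m → ℕ // ∑ j, i j = d} :=
  .of_equiv _ (Sym.equivNatSumOfFintype (Fin m) d)

instance finite_fun_sum_add_one_eq (m d : ℕ) : Finite {i : Fin m → ℕ // ∑ j, i j + 1 = d} :=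
  .of_injective (β := {i : Fin m → ℕ // ∑ j, i j = d - 1})
    (fun i => ⟨i.1, by have := i.2; omega⟩)
    fun _ _ h => Subtype.ext (Subtype.mk.inj h)

theorem card_exponents (m d : ℕ) :
    Nat.card {i : Fin (m + 1) → ℕ // i 0 ≤ 1 ∧ ∑ j, i j = d} =
      m.multichoose d + if 1 ≤ d then m.multichoose (d - 1) else 0 := by
  rw [Nat.card_congr (exponentsEquivSum m d), Nat.card_sum, card_fun_sum_eq]
  cases d with
  | zero => simp
  | succ d => simp [card_fun_sum_eq]


/-- The space `Γ_d(S^{n-1})`, spanned by the restrictions to the unit sphere in `ℝⁿ`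
of the monomials `x₁^{i₁} ⋯ xₙ^{iₙ}` with `i₁ ≤ 1` and `i₁ + ⋯ + iₙ = d`, has
dimension `C(n+d−2, d) + C(n+d−3, d−1)` (the second term being `0` when `d = 0`). -/
theorem finrank_Gamma_d_sphere (n d : ℕ) (hn : 1 ≤ n) :
    Module.finrank ℝ
      (Submodule.span ℝ
        (Set.range (fun i : {i : Fin n → ℕ // i ⟨0, hn⟩ ≤ 1 ∧ ∑ j, i j = d} =>
          fun p : Metric.sphere (0 : EuclideanSpace ℝ (Fin n)) 1 =>
            ∏ j, ((p : EuclideanSpace ℝ (Fin n)) j) ^ (i.1 j))))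
      = (n + d - 2).choose d + (if 1 ≤ d then (n + d - 3).choose (d - 1) else 0) := by
  obtain ⟨m, rfl⟩ := Nat.exists_eq_add_of_le' hn
  have hfin : Finite {i : Fin (m + 1) → ℕ // i ⟨0, hn⟩ ≤ 1 ∧ ∑ j, i j = d} :=
    .of_equiv _ (exponentsEquivSum m d).symm
  have := Fintype.ofFinite {i : Fin (m + 1) → ℕ // i ⟨0, hn⟩ ≤ 1 ∧ ∑ j, i j = d}
  have hli := (linearIndependent_monomials_sphere hn d).comp
    (fun i : {i : Fin (m + 1) → ℕ // i ⟨0, hn⟩ ≤ 1 ∧ ∑ j, i j = d} => ⟨i.1, i.2.2⟩)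
    fun _ _ h => Subtype.ext (Subtype.mk.inj h)
  refine (finrank_span_eq_card hli).trans ?_
  rw [← Nat.card_eq_fintype_card]
  refine (card_exponents m d).trans ?_
  rw [Nat.multichoose_eq, Nat.multichoose_eq, show m + 1 + d - 2 = m + d - 1 by omega]
  split_ifs with hd
  · rw [show m + 1 + d - 3 = m + (d - 1) - 1 by omega]
  · rfl
end

section
/- Let n ≥ 1 and d ≥ 0 be integers. The family of functions from the unit sphere S^{n-1} ⊂ ℝ^n to ℝ obtained by restricting to S^{n-1} the monomials x_1^{i_1} ⋯ x_n^{i_n} with i_1 ≤ 1 and i_1 + ⋯ + i_n ≤ d (one function for each such exponent tuple) is linearly independent over ℝ. -/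
open MvPolynomial in
/-- If `A(y) + t * B(y) = 0` whenever `(t, y)` lies on the unit sphere, then `A = B = 0`. -/
theorem MvPolynomial.eq_zero_of_eval_add_mul_eval_eq_zero {m : ℕ} (A B : MvPolynomial (Fin m) ℝ)
    (h : ∀ (t : ℝ) (y : Fin m → ℝ), t ^ 2 + ∑ j, y j ^ 2 = 1 → eval y A + t * eval y B = 0) :
    A = 0 ∧ B = 0 := by
  have hpos : (0 : ℝ) < 1 / (m + 1) := by positivity
  have key : ∀ y ∈ Set.pi Set.univ fun _ : Fin m => Set.Ioo (0 : ℝ) (1 / (m + 1)),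
      eval y A = 0 ∧ eval y B = 0 := by
    intro y hy
    have hsum : ∑ j, y j ^ 2 < 1 := by
      have hle : ∑ j, y j ^ 2 ≤ ∑ _j : Fin m, (1 / (m + 1) : ℝ) := by
        refine Finset.sum_le_sum fun j _ => ?_
        obtain ⟨h0, h1⟩ := hy j trivial
        have : (1 / (m + 1) : ℝ) ≤ 1 := by
          rw [div_le_one (by positivity)]
          linarith [(Nat.cast_nonneg m : (0 : ℝ) ≤ m)]
        nlinarith
      refine hle.trans_lt ?_
      rw [Finset.sum_const, Finset.card_univ, Fintype.card_fin, nsmul_eq_mul, mul_one_div,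
        div_lt_one (by positivity)]
      linarith
    have hs : 0 < √(1 - ∑ j, y j ^ 2) := Real.sqrt_pos.2 (by linarith)
    have hsq : √(1 - ∑ j, y j ^ 2) ^ 2 = 1 - ∑ j, y j ^ 2 := Real.sq_sqrt (by linarith)
    have h1 := h _ y (by rw [hsq]; ring)
    have h2 := h (-√(1 - ∑ j, y j ^ 2)) y (by rw [neg_sq, hsq]; ring)
    exact ⟨by linarith, (mul_eq_zero.1 (by linarith : _ * eval y B = 0)).resolve_left hs.ne'⟩
  constructor
  · exact funext_set _ (fun _ => Set.Ioo_infinite hpos) fun y hy => by simp [(key y hy).1]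
  · exact funext_set _ (fun _ => Set.Ioo_infinite hpos) fun y hy => by simp [(key y hy).2]

/-- The restrictions to the unit sphere in `ℝⁿ` of the monomials
`x₁^{i₁} ⋯ xₙ^{iₙ}` with `i₁ ≤ 1` and `i₁ + ⋯ + iₙ ≤ d` form a linearly
independent family of real-valued functions on the sphere. -/
theorem monomials_restricted_linearIndependent (n d : ℕ) (hn : 1 ≤ n) :
    LinearIndependent ℝ
      (fun i : {i : Fin n → ℕ // i ⟨0, hn⟩ ≤ 1 ∧ ∑ j, i j ≤ d} =>
        (fun p : Metric.sphere (0 : EuclideanSpace ℝ (Fin n)) 1 =>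
          ∏ j, ((p : EuclideanSpace ℝ (Fin n)) j) ^ (i.1 j))) := by
  obtain ⟨m, rfl⟩ := Nat.exists_eq_add_of_le' hn
  rw [linearIndependent_iff']
  intro s g hg
  let P (e : ℕ) : MvPolynomial (Fin m) ℝ := ∑ i ∈ s with i.1 0 = e,
    MvPolynomial.monomial (Finsupp.equivFunOnFinite.symm (Fin.tail i.1)) (g i)
  have heval (e : ℕ) (y : Fin m → ℝ) :
      MvPolynomial.eval y (P e) = ∑ i ∈ s with i.1 0 = e, g i * ∏ j, y j ^ i.1 j.succ := by
    simp [P, MvPolynomial.eval_monomial, Finsupp.prod_fintype, Fin.tail]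
  have hP : P 0 = 0 ∧ P 1 = 0 := by
    refine MvPolynomial.eq_zero_of_eval_add_mul_eval_eq_zero _ _ fun t y hty => ?_
    have hp : WithLp.toLp 2 (Fin.cons t y : Fin (m + 1) → ℝ) ∈
        Metric.sphere (0 : EuclideanSpace ℝ (Fin (m + 1))) 1 := by
      simp [EuclideanSpace.norm_eq, Fin.sum_univ_succ, hty]
    have h := congrFun hg ⟨_, hp⟩
    simp only [Finset.sum_apply, Pi.smul_apply, smul_eq_mul, Fin.prod_univ_succ, Fin.cons_zero,
      Fin.cons_succ, Pi.zero_apply] at h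
    rw [heval, heval, Finset.mul_sum, Finset.sum_filter, Finset.sum_filter,
      ← Finset.sum_add_distrib]
    refine (Finset.sum_congr rfl fun i _ => ?_).trans h
    have hi : i.1 0 ≤ 1 := i.2.1
    rcases Nat.le_one_iff_eq_zero_or_eq_one.1 hi with h0 | h0
    · simp [h0]
    · simp [h0]; ring
  intro i hi
  have hcoeff : (P (i.1 0)).coeff (Finsupp.equivFunOnFinite.symm (Fin.tail i.1)) = g i := by
    simp only [P, MvPolynomial.coeff_sum, MvPolynomial.coeff_monomial]
    rw [Finset.sum_eq_single i]
    · simp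
    · intro k hk hki
      refine if_neg fun htail => hki (Subtype.ext ?_)
      rw [← Fin.cons_self_tail k.1, ← Fin.cons_self_tail i.1, (Finset.mem_filter.1 hk).2,
        Finsupp.equivFunOnFinite.symm.injective htail]
    · intro hmem
      rw [Finset.mem_filter] at hmem
      exact (hmem ⟨hi, Eq.refl (i.1 0)⟩).elim
  have hi1 : i.1 0 ≤ 1 := i.2.1
  rcases Nat.le_one_iff_eq_zero_or_eq_one.1 hi1 with h0 | h0
  · rw [← hcoeff, h0, hP.1, MvPolynomial.coeff_zero]
  · rw [← hcoeff, h0, hP.2, MvPolynomial.coeff_zero]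
end

section
/- Let n ≥ 1 and d ≥ 0 be integers and let f ∈ ℝ[x_1,…,x_n] be a polynomial of total degree at most d. Then there exists a polynomial g ∈ ℝ[x_1,…,x_n] of total degree at most d, lying in the linear span of the monomials x_1^{i_1} ⋯ x_n^{i_n} with i_1 ≤ 1, such that f(P) = g(P) for every point P on the unit sphere S^{n-1} ⊂ ℝ^n. -/
open MvPolynomial in
/-- Restriction of polynomials to the affine quadric `∑ j, x j ^ 2 = 1`, as a linear map. -/
noncomputable def MvPolynomial.restrictSphere_s9 (σ R : Type*) [Fintype σ] [CommRing R] :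
    MvPolynomial σ R →ₗ[R] ({p : σ → R // ∑ j, p j ^ 2 = 1} → R) :=
  LinearMap.pi fun p => (aeval p.1).toLinearMap

open MvPolynomial in
/-- Polynomials of total degree at most `d` spanned by monomials whose exponent of `z` is at
most one. -/
noncomputable def MvPolynomial.sphereReduced {σ : Type*} (R : Type*) [CommRing R] (z : σ) (d : ℕ) :
    Submodule R (MvPolynomial σ R) :=
  restrictTotalDegree σ R d ⊓
    Submodule.span R {q | ∃ i : σ →₀ ℕ, i z ≤ 1 ∧ q = monomial i 1}

open MvPolynomial in
/-- On the sphere, the square of the variable `z` can be traded for the squares of the others. -/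
theorem MvPolynomial.restrictSphere_monomial_add_single_two {σ R : Type*} [Fintype σ]
    [DecidableEq σ] [CommRing R] (z : σ) (j : σ →₀ ℕ) :
    restrictSphere_s9 σ R (monomial (j + Finsupp.single z 2) 1) =
      restrictSphere_s9 σ R (monomial j 1) -
        ∑ k ∈ Finset.univ.erase z, restrictSphere_s9 σ R (monomial (j + Finsupp.single k 2) 1) := by
  ext ⟨p, hp⟩
  have h_mon (k : σ) : (monomial (j + Finsupp.single k 2) 1 : MvPolynomial σ R) =
      monomial j 1 * X k ^ 2 := by
    rw [X_pow_eq_monomial, monomial_mul, one_mul]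
  rw [← Finset.add_sum_erase _ _ (Finset.mem_univ z)] at hp
  simp only [restrictSphere_s9, h_mon, LinearMap.pi_apply, AlgHom.toLinearMap_apply, map_mul,
    map_pow, aeval_X, Pi.sub_apply, Finset.sum_apply, ← Finset.mul_sum]
  linear_combination (aeval p (monomial j (1 : R))) * hp

open MvPolynomial in
theorem MvPolynomial.restrictSphere_monomial_mem_map_sphereReduced {σ R : Type*} [Fintype σ]
    [CommRing R] (z : σ) (d : ℕ) (i : σ →₀ ℕ) (hi : i.degree ≤ d) :
    restrictSphere_s9 σ R (monomial i 1) ∈ (sphereReduced R z d).map (restrictSphere_s9 σ R) := by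
  classical
  induction h_exp : i z using Nat.strong_induction_on generalizing i with
  | _ m ih =>
    by_cases h_le : i z ≤ 1
    · refine Submodule.mem_map_of_mem ⟨?_, Submodule.subset_span ⟨i, h_le, rfl⟩⟩
      rw [SetLike.mem_coe, mem_restrictTotalDegree]
      exact (totalDegree_monomial_le i 1).trans hi
    · obtain ⟨j, rfl⟩ : ∃ j, i = j + Finsupp.single z 2 :=
        ⟨i - Finsupp.single z 2, (tsub_add_cancel_of_le
          (Finsupp.single_le_iff.2 (by omega))).symm⟩
      simp only [map_add, Finsupp.degree_single, Finsupp.add_apply,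
        Finsupp.single_eq_same] at hi h_exp
      rw [restrictSphere_monomial_add_single_two]
      refine Submodule.sub_mem _ (ih (j z) (by omega) j (by omega) rfl)
        (Submodule.sum_mem _ fun k hk => ih (j z) (by omega) _ ?_ ?_)
      · simpa using hi
      · simp [(Finset.ne_of_mem_erase hk).symm]

open MvPolynomial in
/-- Every polynomial of total degree at most `d` has a reduced representative on the sphere. -/
theorem MvPolynomial.restrictSphere_mem_map_sphereReduced {σ R : Type*} [Fintype σ]
    [CommRing R] (z : σ) (d : ℕ) (f : MvPolynomial σ R) (hf : f.totalDegree ≤ d) :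
    restrictSphere_s9 σ R f ∈ (sphereReduced R z d).map (restrictSphere_s9 σ R) := by
  rw [f.as_sum, map_sum]
  refine Submodule.sum_mem _ fun i hi => ?_
  rw [← mul_one (coeff i f), ← smul_eq_mul, ← smul_monomial, map_smul]
  exact Submodule.smul_mem _ _ (restrictSphere_monomial_mem_map_sphereReduced z d i
    ((le_totalDegree hi).trans hf))


/-- Canonical reduction modulo the ideal of the sphere: every real polynomial `f`
in `n` variables of total degree at most `d` agrees on the unit sphere `S^{n-1}`
with a polynomial `g` of total degree at most `d` lying in the span of the
monomials whose exponent of `x₁` is at most `1`. -/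
theorem reduction_modulo_sphere_ideal (n d : ℕ) (hn : 1 ≤ n)
    (f : MvPolynomial (Fin n) ℝ) (hf : f.totalDegree ≤ d) :
    ∃ g : MvPolynomial (Fin n) ℝ, g.totalDegree ≤ d ∧
      g ∈ Submodule.span ℝ
        {q : MvPolynomial (Fin n) ℝ |
          ∃ i : Fin n →₀ ℕ, i ⟨0, hn⟩ ≤ 1 ∧ q = MvPolynomial.monomial i 1} ∧
      ∀ p ∈ Metric.sphere (0 : EuclideanSpace ℝ (Fin n)) 1,
        MvPolynomial.eval (fun j => p j) f = MvPolynomial.eval (fun j => p j) g := by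
  obtain ⟨g, ⟨h_deg, h_span⟩, h_eq⟩ :=
    MvPolynomial.restrictSphere_mem_map_sphereReduced (⟨0, hn⟩ : Fin n) d f hf
  refine ⟨g, (MvPolynomial.mem_restrictTotalDegree _ _ _).1 h_deg, h_span, fun p hp => ?_⟩
  have h_sum : ∑ j, p j ^ 2 = 1 := by
    rw [← EuclideanSpace.real_norm_sq_eq, mem_sphere_zero_iff_norm.1 hp, one_pow]
  simpa [MvPolynomial.restrictSphere_s9, MvPolynomial.aeval_eq_eval] using
    (congrFun h_eq ⟨fun j => p j, h_sum⟩).symm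
end

section
/- Let n and s be positive integers, let v_1, …, v_m be distinct unit vectors in ℝ^n, and let t_1, …, t_s be distinct real numbers, all different from 1, such that ⟨v_i, v_j⟩ ∈ {t_1, …, t_s} for all i ≠ j. Define f_i : ℝ^n → ℝ by f_i(x) = (∏_{k=1}^s (⟨x, v_i⟩ − t_k)) / (∏_{k=1}^s (1 − t_k)). Then f_i(v_j) = δ_{ij} (i.e., f_i(v_i) = 1 and f_i(v_j) = 0 for i ≠ j), and consequently the functions f_1, …, f_m are linearly independent in the real vector space of functions ℝ^n → ℝ. -/
open scoped RealInnerProductSpace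

/-- For distinct unit vectors `v 1, …, v m` in `ℝⁿ` whose pairwise inner products all
lie in `{t 1, …, t s}` with the `t k` distinct and different from `1`, the functions
`f i (x) = (∏ₖ (⟨x, v i⟩ − t k)) / (∏ₖ (1 − t k))` satisfy `f i (v j) = δ_{ij}` and
are linearly independent in the space of functions `ℝⁿ → ℝ`. -/
theorem interpolation_functions_linearIndependent (n s m : ℕ) (hn : 0 < n) (hs : 0 < s)
    (v : Fin m → EuclideanSpace ℝ (Fin n)) (hv : Function.Injective v)
    (hunit : ∀ i, ‖v i‖ = 1)
    (t : Fin s → ℝ) (ht : Function.Injective t) (ht1 : ∀ k, t k ≠ 1)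
    (hP : ∀ i j, i ≠ j → ∃ k, ⟪v i, v j⟫ = t k)
    (f : Fin m → EuclideanSpace ℝ (Fin n) → ℝ)
    (hf : ∀ i x, f i x = (∏ k, (⟪x, v i⟫ - t k)) / (∏ k, (1 - t k))) :
    (∀ i j, f i (v j) = if i = j then 1 else 0) ∧ LinearIndependent ℝ f := by
  have hne : (∏ k, (1 - t k)) ≠ 0 :=
    Finset.prod_ne_zero_iff.mpr fun k _ => sub_ne_zero.mpr (ht1 k).symm
  have hδ : ∀ i j, f i (v j) = if i = j then 1 else 0 := by
    intro i j
    rw [hf]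
    split_ifs with h
    · subst h
      rw [real_inner_self_eq_norm_sq, hunit, one_pow, div_self hne]
    · obtain ⟨k, hk⟩ := hP j i (Ne.symm h)
      rw [Finset.prod_eq_zero (Finset.mem_univ k) (sub_eq_zero.mpr hk), zero_div]
  refine ⟨hδ, Fintype.linearIndependent_iff.mpr fun g hg j => ?_⟩
  simpa [Finset.sum_apply, hδ] using congrFun hg (v j)
end
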